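/- arXiv:2003.06243 — 11 statements merged into one kernel-verified Lean document; each statement's English description precedes it below -/
import Mathlib

section
/- Under assumptions (A1)–(A4), suppose {δ_l} is a sequence of positive reals decreasing to 0, {z^k} is a feasible trajectory with f(z^k, z^{k+1}) < 0 for all k, and σ : ℕ → ℕ is strictly increasing such that for every l the point x^l = z^{σ(l)} satisfies f(x^l, y) ≥ −δ_l for all y ∈ D(x^l) (the record points produced by the threshold descent method TDM). Then the sequence {x^l} has at least one limit point, and every limit point x̄ of {x^l} solves Problem (P1), i.e. f(x̄, y) ≥ 0 for all y ∈ D(x̄). -/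
/-- Theorem 3.1: under (A1)–(A4), the record points `x^l = z^(σ l)` produced by the
threshold descent method have limit points, and every limit point solves Problem (P1). -/
theorem tdm_convergence
    {E : Type*} [MetricSpace E]
    (X : Set E) (hXne : X.Nonempty) (hXcl : IsClosed X)
    (φ c : E → E → ℝ)
    -- (A1): continuity of φ and c on X × X, nonnegativity of c, c(x,x) = 0
    (hφcont : ContinuousOn (fun p : E × E => φ p.1 p.2) (X ×ˢ X))
    (hccont : ContinuousOn (fun p : E × E => c p.1 p.2) (X ×ˢ X))
    (hcnn : ∀ x ∈ X, ∀ y ∈ X, 0 ≤ c x y)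
    (hcxx : ∀ x ∈ X, c x x = 0)
    -- the feasible-moves mapping D
    (D : E → Set E)
    (hDX : ∀ x ∈ X, D x ⊆ X)
    -- (A3): x ∈ D(x) and D is lower semicontinuous on X
    (hxD : ∀ x ∈ X, x ∈ D x)
    (hDlsc : ∀ z ∈ X, ∀ x : ℕ → E, (∀ k, x k ∈ X) →
      Filter.Tendsto x Filter.atTop (nhds z) → ∀ t ∈ D z,
      ∃ tk : ℕ → E, (∀ k, tk k ∈ D (x k)) ∧ Filter.Tendsto tk Filter.atTop (nhds t))
    -- (A2): every superlevel set X_α is compact; every bounded subset of X lies in some X_β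
    (hA2a : ∀ α : ℝ, IsCompact {x ∈ X | α ≤ φ x x})
    (hA2b : ∀ S : Set E, S ⊆ X → Bornology.IsBounded S →
      ∃ β : ℝ, S ⊆ {x ∈ X | β ≤ φ x x})
    -- (A4)(i): [b(z^k,z^{k+1}) - c(z^k,z^{k+1})]₊ → 0 along every feasible trajectory
    (hA4i : ∀ z : ℕ → E, z 0 ∈ X → (∀ k, z (k + 1) ∈ D (z k)) →
      Filter.Tendsto
        (fun k => max (max (φ (z k) (z (k + 1)) - φ (z (k + 1)) (z (k + 1))) 0
          - c (z k) (z (k + 1))) 0) Filter.atTop (nhds 0))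
    -- (A4)(ii): Σ [b - c]₊ < ∞ along every unbounded feasible trajectory
    (hA4ii : ∀ z : ℕ → E, z 0 ∈ X → (∀ k, z (k + 1) ∈ D (z k)) →
      ¬ Bornology.IsBounded (Set.range z) →
      Summable (fun k => max (max (φ (z k) (z (k + 1)) - φ (z (k + 1)) (z (k + 1))) 0
        - c (z k) (z (k + 1))) 0))
    -- the thresholds δ_l ↘ 0
    (δ : ℕ → ℝ) (hδpos : ∀ l, 0 < δ l) (hδanti : Antitone δ)
    (hδ0 : Filter.Tendsto δ Filter.atTop (nhds 0))
    -- the feasible trajectory z with f(z^k, z^{k+1}) < 0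
    (z : ℕ → E) (hz0 : z 0 ∈ X) (hzD : ∀ k, z (k + 1) ∈ D (z k))
    (hdesc : ∀ k, φ (z k) (z k) + c (z k) (z (k + 1)) - φ (z k) (z (k + 1)) < 0)
    -- the record points x^l = z^(σ l) satisfying f(x^l, y) ≥ -δ_l on D(x^l)
    (σ : ℕ → ℕ) (hσ : StrictMono σ)
    (hrec : ∀ l, ∀ y ∈ D (z (σ l)),
      -δ l ≤ φ (z (σ l)) (z (σ l)) + c (z (σ l)) y - φ (z (σ l)) y) :
    (∃ xb : E, ∃ τ : ℕ → ℕ, StrictMono τ ∧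
      Filter.Tendsto (fun s => z (σ (τ s))) Filter.atTop (nhds xb)) ∧
    (∀ xb : E, (∃ τ : ℕ → ℕ, StrictMono τ ∧
        Filter.Tendsto (fun s => z (σ (τ s))) Filter.atTop (nhds xb)) →
      ∀ y ∈ D xb, 0 ≤ φ xb xb + c xb y - φ xb y) := by
  have hzX : ∀ k, z k ∈ X := by
    intro k
    induction k with
    | zero => exact hz0
    | succ k ih => exact hDX _ ih (hzD k)
  have hα : ∃ α : ℝ, ∀ k, z k ∈ {x ∈ X | α ≤ φ x x} := by
    by_cases hb : Bornology.IsBounded (Set.range z)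
    · obtain ⟨β, hβ⟩ := hA2b (Set.range z) (by rintro _ ⟨k, rfl⟩; exact hzX k) hb
      exact ⟨β, fun k => hβ ⟨k, rfl⟩⟩
    · have hs := hA4ii z hz0 hzD hb
      set a : ℕ → ℝ := fun k => max (max (φ (z k) (z (k + 1)) - φ (z (k + 1)) (z (k + 1))) 0
        - c (z k) (z (k + 1))) 0 with ha
      have hstep : ∀ k, φ (z k) (z k) - a k ≤ φ (z (k + 1)) (z (k + 1)) := by
        intro k
        have h1 : max (φ (z k) (z (k + 1)) - φ (z (k + 1)) (z (k + 1))) 0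
          - c (z k) (z (k + 1)) ≤ a k := le_max_left _ _
        have h2 := le_max_left (φ (z k) (z (k + 1)) - φ (z (k + 1)) (z (k + 1))) 0
        have h3 := hdesc k
        linarith
      have hsum : ∀ k, φ (z 0) (z 0) - ∑ i ∈ Finset.range k, a i ≤ φ (z k) (z k) := by
        intro k
        induction k with
        | zero => simp
        | succ k ih =>
          rw [Finset.sum_range_succ]
          have := hstep k
          linarith
      refine ⟨φ (z 0) (z 0) - ∑' i, a i, fun k => ⟨hzX k, ?_⟩⟩
      have h4 := hs.sum_le_tsum (Finset.range k) (fun i _ => le_max_right _ _)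
      have h5 := hsum k
      linarith
  obtain ⟨α, hα⟩ := hα
  constructor
  · obtain ⟨xb, -, τ, hτ, h⟩ := (hA2a α).tendsto_subseq (fun l => hα (σ l))
    exact ⟨xb, τ, hτ, h⟩
  · rintro xb ⟨τ, hτ, hlim⟩ y hy
    have hxb : xb ∈ X := hXcl.mem_of_tendsto hlim (Filter.Eventually.of_forall fun s => hzX _)
    obtain ⟨t, htD, ht⟩ := hDlsc xb hxb _ (fun s => hzX (σ (τ s))) hlim y hy
    have key : ∀ g : E → E → ℝ, ContinuousOn (fun p : E × E => g p.1 p.2) (X ×ˢ X) →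
        ∀ w : ℕ → E, (∀ k, w k ∈ X) → ∀ v ∈ X, Filter.Tendsto w Filter.atTop (nhds v) →
        Filter.Tendsto (fun s => g (z (σ (τ s))) (w s)) Filter.atTop (nhds (g xb v)) := by
      intro g hg w hw v hv hwv
      have h1 : Filter.Tendsto (fun s => (z (σ (τ s)), w s)) Filter.atTop
          (nhdsWithin (xb, v) (X ×ˢ X)) :=
        tendsto_nhdsWithin_iff.2 ⟨hlim.prodMk_nhds hwv,
          Filter.Eventually.of_forall fun s => ⟨hzX _, hw s⟩⟩
      exact (hg (xb, v) ⟨hxb, hv⟩).tendsto.comp h1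
    have htX : ∀ s, t s ∈ X := fun s => hDX _ (hzX _) (htD s)
    have hyX : y ∈ X := hDX _ hxb hy
    have hL := ((key φ hφcont _ (fun s => hzX _) xb hxb hlim).add
      (key c hccont t htX y hyX ht)).sub (key φ hφcont t htX y hyX ht)
    have hR := (hδ0.comp hτ.tendsto_atTop).neg
    rw [neg_zero] at hR
    exact le_of_tendsto_of_tendsto' hR hL (fun s => hrec (τ s) (t s) (htD s))
end

section
/- (Step 1 of the proof of Theorem 3.1.) Suppose u is bounded above on X, and suppose [b(z^k,z^{k+1}) − c(z^k,z^{k+1})]_+ → 0 along every feasible trajectory. Then for every δ > 0 there is no feasible trajectory {z^k} satisfying f(z^k, z^{k+1}) < −δ for all k; equivalently, any feasible trajectory with descent threshold δ must after finitely many steps reach a point z^k such that no y ∈ D(z^k) has f(z^k, y) < −δ. -/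
/-- Step 1 of the proof of Theorem 3.1: if u is bounded above on X and
[b - c]₊ → 0 along every feasible trajectory, then for every δ > 0 there is no
feasible trajectory with f(z^k, z^{k+1}) < -δ for all k. -/
theorem tdm_step1
    {E : Type*} [MetricSpace E]
    (X : Set E) (hXne : X.Nonempty) (hXcl : IsClosed X)
    (φ c : E → E → ℝ)
    (hcnn : ∀ x ∈ X, ∀ y ∈ X, 0 ≤ c x y)
    (hcxx : ∀ x ∈ X, c x x = 0)
    (D : E → Set E)
    (hDX : ∀ x ∈ X, D x ⊆ X)
    (hxD : ∀ x ∈ X, x ∈ D x)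
    -- u is bounded above on X
    (hubdd : ∃ M : ℝ, ∀ x ∈ X, φ x x ≤ M)
    -- [b(z^k,z^{k+1}) - c(z^k,z^{k+1})]₊ → 0 along every feasible trajectory
    (hA4i : ∀ z : ℕ → E, z 0 ∈ X → (∀ k, z (k + 1) ∈ D (z k)) →
      Filter.Tendsto
        (fun k => max (max (φ (z k) (z (k + 1)) - φ (z (k + 1)) (z (k + 1))) 0
          - c (z k) (z (k + 1))) 0) Filter.atTop (nhds 0)) :
    ∀ δ : ℝ, 0 < δ →
      ¬ ∃ z : ℕ → E, z 0 ∈ X ∧ (∀ k, z (k + 1) ∈ D (z k)) ∧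
        ∀ k, φ (z k) (z k) + c (z k) (z (k + 1)) - φ (z k) (z (k + 1)) < -δ := by
  rintro δ hδ ⟨z, hz0, hz, hf⟩
  obtain ⟨M, hM⟩ := hubdd
  have hX : ∀ k, z k ∈ X := by
    intro k
    induction k with
    | zero => exact hz0
    | succ k ih => exact hDX _ ih (hz k)
  have hev := (hA4i z hz0 hz).eventually (gt_mem_nhds (half_pos hδ))
  obtain ⟨N, hN⟩ := Filter.eventually_atTop.1 hev
  have step : ∀ k, N ≤ k → φ (z k) (z k) + δ / 2 ≤ φ (z (k + 1)) (z (k + 1)) := by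
    intro k hk
    have h1 := hN k hk
    have h2 := le_max_left (max (φ (z k) (z (k + 1)) - φ (z (k + 1)) (z (k + 1))) 0
          - c (z k) (z (k + 1))) 0
    have h3 := le_max_left (φ (z k) (z (k + 1)) - φ (z (k + 1)) (z (k + 1))) 0
    have h4 := hf k
    linarith
  have grow : ∀ n : ℕ, φ (z N) (z N) + n * (δ / 2) ≤ φ (z (N + n)) (z (N + n)) := by
    intro n
    induction n with
    | zero => simp
    | succ n ih =>
      have h := step (N + n) (Nat.le_add_right _ _)
      rw [← Nat.add_assoc]
      push_cast
      linarith
  obtain ⟨n, hn⟩ := exists_nat_gt ((M - φ (z N) (z N)) / (δ / 2))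
  rw [div_lt_iff₀ (half_pos hδ)] at hn
  have h1 := grow n
  have h2 := hM _ (hX (N + n))
  linarith
end

section
/- (Step 2 of the proof of Theorem 3.1.) Assume (A2): for every α ∈ ℝ the set X_α = {x ∈ X : u(x) ≥ α} is compact, and every bounded subset of X is contained in some X_β. Assume also that Σ_k [b(z^k,z^{k+1}) − c(z^k,z^{k+1})]_+ < ∞ along every unbounded feasible trajectory. Then every feasible trajectory {z^k} satisfying f(z^k, z^{k+1}) < 0 for all k is bounded. -/
/-- Step 2 of the proof of Theorem 3.1: under (A2) and (A4)(ii), every feasible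
trajectory with f(z^k, z^{k+1}) < 0 for all k is bounded. -/
theorem tdm_step2
    {E : Type*} [MetricSpace E]
    (X : Set E) (hXne : X.Nonempty) (hXcl : IsClosed X)
    (φ c : E → E → ℝ)
    (hcnn : ∀ x ∈ X, ∀ y ∈ X, 0 ≤ c x y)
    (hcxx : ∀ x ∈ X, c x x = 0)
    (D : E → Set E)
    (hDX : ∀ x ∈ X, D x ⊆ X)
    (hxD : ∀ x ∈ X, x ∈ D x)
    -- (A2): every superlevel set X_α is compact; every bounded subset of X lies in some X_β
    (hA2a : ∀ α : ℝ, IsCompact {x ∈ X | α ≤ φ x x})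
    (hA2b : ∀ S : Set E, S ⊆ X → Bornology.IsBounded S →
      ∃ β : ℝ, S ⊆ {x ∈ X | β ≤ φ x x})
    -- (A4)(ii): Σ [b - c]₊ < ∞ along every unbounded feasible trajectory
    (hA4ii : ∀ z : ℕ → E, z 0 ∈ X → (∀ k, z (k + 1) ∈ D (z k)) →
      ¬ Bornology.IsBounded (Set.range z) →
      Summable (fun k => max (max (φ (z k) (z (k + 1)) - φ (z (k + 1)) (z (k + 1))) 0
        - c (z k) (z (k + 1))) 0)) :
    ∀ z : ℕ → E, z 0 ∈ X → (∀ k, z (k + 1) ∈ D (z k)) →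
      (∀ k, φ (z k) (z k) + c (z k) (z (k + 1)) - φ (z k) (z (k + 1)) < 0) →
      Bornology.IsBounded (Set.range z) := by
  intro z h0 hz hf
  by_contra hb
  have hs := hA4ii z h0 hz hb
  apply hb
  have hX : ∀ k, z k ∈ X := by
    intro k
    induction k with
    | zero => exact h0
    | succ k ih => exact hDX _ ih (hz k)
  set g : ℕ → ℝ := fun k => max (max (φ (z k) (z (k + 1)) - φ (z (k + 1)) (z (k + 1))) 0
        - c (z k) (z (k + 1))) 0 with hg
  have hle : ∀ n, φ (z 0) (z 0) - ∑ k ∈ Finset.range n, g k ≤ φ (z n) (z n) := by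
    intro n
    induction n with
    | zero => simp
    | succ n ih =>
      rw [Finset.sum_range_succ]
      have h1 := hf n
      have h2 : max (φ (z n) (z (n + 1)) - φ (z (n + 1)) (z (n + 1))) 0
        - c (z n) (z (n + 1)) ≤ g n := le_max_left _ _
      have h3 := le_max_left (φ (z n) (z (n + 1)) - φ (z (n + 1)) (z (n + 1))) 0
      linarith
  refine (hA2a (φ (z 0) (z 0) - ∑' k, g k)).isBounded.subset ?_
  rintro _ ⟨n, rfl⟩
  refine ⟨hX n, ?_⟩
  have h4 : ∑ k ∈ Finset.range n, g k ≤ ∑' k, g k :=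
    hs.sum_le_tsum _ (fun k _ => le_max_right _ _)
  linarith [hle n]
end

section
/- Under assumptions (A1)–(A4), Problem (P1) has a solution: there exists x* ∈ X such that f(x*, y) ≥ 0 for all y ∈ D(x*). -/
/-- Under assumptions (A1)–(A4), Problem (P1) has a solution. -/
theorem exists_solution_P1
    {E : Type*} [MetricSpace E]
    (X : Set E) (hXne : X.Nonempty) (hXcl : IsClosed X)
    (φ c : E → E → ℝ)
    -- (A1)
    (hφcont : ContinuousOn (fun p : E × E => φ p.1 p.2) (X ×ˢ X))
    (hccont : ContinuousOn (fun p : E × E => c p.1 p.2) (X ×ˢ X))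
    (hcnn : ∀ x ∈ X, ∀ y ∈ X, 0 ≤ c x y)
    (hcxx : ∀ x ∈ X, c x x = 0)
    (D : E → Set E)
    (hDX : ∀ x ∈ X, D x ⊆ X)
    -- (A3)
    (hxD : ∀ x ∈ X, x ∈ D x)
    (hDlsc : ∀ z ∈ X, ∀ x : ℕ → E, (∀ k, x k ∈ X) →
      Filter.Tendsto x Filter.atTop (nhds z) → ∀ t ∈ D z,
      ∃ tk : ℕ → E, (∀ k, tk k ∈ D (x k)) ∧ Filter.Tendsto tk Filter.atTop (nhds t))
    -- (A2)
    (hA2a : ∀ α : ℝ, IsCompact {x ∈ X | α ≤ φ x x})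
    (hA2b : ∀ S : Set E, S ⊆ X → Bornology.IsBounded S →
      ∃ β : ℝ, S ⊆ {x ∈ X | β ≤ φ x x})
    -- (A4)(i)
    (hA4i : ∀ z : ℕ → E, z 0 ∈ X → (∀ k, z (k + 1) ∈ D (z k)) →
      Filter.Tendsto
        (fun k => max (max (φ (z k) (z (k + 1)) - φ (z (k + 1)) (z (k + 1))) 0
          - c (z k) (z (k + 1))) 0) Filter.atTop (nhds 0))
    -- (A4)(ii)
    (hA4ii : ∀ z : ℕ → E, z 0 ∈ X → (∀ k, z (k + 1) ∈ D (z k)) →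
      ¬ Bornology.IsBounded (Set.range z) →
      Summable (fun k => max (max (φ (z k) (z (k + 1)) - φ (z (k + 1)) (z (k + 1))) 0
        - c (z k) (z (k + 1))) 0)) :
    ∃ xs ∈ X, ∀ y ∈ D xs, 0 ≤ φ xs xs + c xs y - φ xs y := by
  classical
  -- greedy choice of the next state
  have key : ∀ x : X, ∃ y : X, (y : E) ∈ D x ∧ 0 ≤ φ x y - c x y - φ x x ∧
      ∀ t ∈ D x, min 1 (φ x t - c x t - φ x x) ≤ 2 * (φ x y - c x y - φ x x) := by
    rintro ⟨x, hx⟩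
    set S : Set ℝ := (fun t => min 1 (φ x t - c x t - φ x x)) '' D x with hS
    have hbdd : BddAbove S := by
      refine ⟨1, ?_⟩
      rintro _ ⟨t, -, rfl⟩
      exact min_le_left _ _
    have h0 : (0 : ℝ) ∈ S := by
      refine ⟨x, hxD x hx, ?_⟩
      simp [hcxx x hx]
    have hle : ∀ t ∈ D x, min 1 (φ x t - c x t - φ x x) ≤ sSup S := fun t ht =>
      le_csSup hbdd ⟨t, ht, rfl⟩
    have hg : 0 ≤ sSup S := le_csSup hbdd h0
    rcases hg.eq_or_lt with hg | hg
    · refine ⟨⟨x, hx⟩, hxD x hx, ?_, ?_⟩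
      · simp [hcxx x hx]
      · intro t ht
        have := hle t ht
        simp only [hcxx x hx]
        linarith
    · obtain ⟨_, ⟨y, hy, rfl⟩, hlt⟩ := exists_lt_of_lt_csSup ⟨0, h0⟩ (half_lt_self hg)
      have h2 : min 1 (φ x y - c x y - φ x x) ≤ φ x y - c x y - φ x x := min_le_right _ _
      simp only at hlt
      refine ⟨⟨y, hDX x hx hy⟩, hy, ?_, ?_⟩
      · simp only
        linarith
      · intro t ht
        have := hle t ht
        simp only
        linarith
  choose F hFD hF0 hF using key
  obtain ⟨x0, hx0⟩ := hXne
  set w : ℕ → X := fun k => F^[k] ⟨x0, hx0⟩ with hw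
  have hwS : ∀ k, w (k + 1) = F (w k) := fun k => Function.iterate_succ_apply' F k _
  set z : ℕ → E := fun k => (w k : E) with hz
  have hzX : ∀ k, z k ∈ X := fun k => (w k).2
  have hzD : ∀ k, z (k + 1) ∈ D (z k) := by
    intro k
    simp only [hz, hwS]
    exact hFD _
  obtain ⟨δ, hδ⟩ : ∃ δ : ℕ → ℝ,
      ∀ k, δ k = φ (z k) (z (k + 1)) - c (z k) (z (k + 1)) - φ (z k) (z k) := ⟨_, fun _ => rfl⟩
  have hδ0 : ∀ k, 0 ≤ δ k := by
    intro k
    rw [hδ]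
    simp only [hz, hwS]
    exact hF0 _
  have hδt : ∀ k, ∀ t ∈ D (z k),
      min 1 (φ (z k) t - c (z k) t - φ (z k) (z k)) ≤ 2 * δ k := by
    intro k t ht
    rw [hδ]
    simp only [hz, hwS]
    exact hF _ t ht
  have hi := hA4i z (hzX 0) hzD
  have hii := hA4ii z (hzX 0) hzD
  obtain ⟨e, he⟩ : ∃ e : ℕ → ℝ, e = (fun k =>
      max (max (φ (z k) (z (k + 1)) - φ (z (k + 1)) (z (k + 1))) 0
          - c (z k) (z (k + 1))) 0) := ⟨_, rfl⟩
  rw [← he] at hi hii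
  have he0 : ∀ k, 0 ≤ e k := by
    intro k
    rw [he]
    exact le_max_right _ _
  have hstep : ∀ k, φ (z k) (z k) + δ k - e k ≤ φ (z (k + 1)) (z (k + 1)) := by
    intro k
    have h1 : max (φ (z k) (z (k + 1)) - φ (z (k + 1)) (z (k + 1))) 0
          - c (z k) (z (k + 1)) ≤ e k := by
      rw [he]
      exact le_max_left _ _
    have h2 := le_max_left (φ (z k) (z (k + 1)) - φ (z (k + 1)) (z (k + 1))) 0
    rw [hδ]
    linarith
  -- the trajectory is bounded
  have hbd : Bornology.IsBounded (Set.range z) := by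
    by_contra hub
    have hsum := hii hub
    have hlow : ∀ k, φ (z 0) (z 0) - ∑ i ∈ Finset.range k, e i ≤ φ (z k) (z k) := by
      intro k
      induction k with
      | zero => simp
      | succ k ih =>
        rw [Finset.sum_range_succ]
        have := hstep k
        have := hδ0 k
        linarith
    apply hub
    refine (hA2a (φ (z 0) (z 0) - ∑' i, e i)).isBounded.subset ?_
    rintro _ ⟨k, rfl⟩
    refine ⟨hzX k, ?_⟩
    have h1 := hlow k
    have h2 := hsum.sum_le_tsum (Finset.range k) (fun i _ => he0 i)
    linarith
  obtain ⟨β, hβ⟩ := hA2b _ (by rintro _ ⟨k, rfl⟩; exact hzX k) hbd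
  have hzK : ∀ k, z k ∈ {x ∈ X | β ≤ φ x x} := fun k => hβ ⟨k, rfl⟩
  have hucont : ContinuousOn (fun x => φ x x) X :=
    hφcont.comp (f := fun x : E => (x, x)) (by fun_prop) (fun x hx => ⟨hx, hx⟩)
  obtain ⟨M, hM⟩ := (hA2a β).bddAbove_image (hucont.mono (fun x hx => hx.1))
  have hzM : ∀ k, φ (z k) (z k) ≤ M := fun k => hM ⟨z k, hzK k, rfl⟩
  -- the increments are small infinitely often
  have hinf : ∀ n : ℕ, ∃ k, δ k < 1 / ((n : ℝ) + 1) := by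
    intro n
    by_contra! hcon
    have hd : 0 < 1 / ((n : ℝ) + 1) := by positivity
    obtain ⟨d, hdd⟩ : ∃ d, d = 1 / ((n : ℝ) + 1) := ⟨_, rfl⟩
    rw [← hdd] at hcon hd
    obtain ⟨N, hN⟩ := Filter.eventually_atTop.1 (hi.eventually (gt_mem_nhds (half_pos hd)))
    have hgrow : ∀ m : ℕ, φ (z N) (z N) + m * (d / 2) ≤ φ (z (N + m)) (z (N + m)) := by
      intro m
      induction m with
      | zero => simp
      | succ m ih =>
        have h1 := hstep (N + m)
        have h2 := hcon (N + m)
        have h3 := hN (N + m) (by omega)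
        rw [← add_assoc]
        push_cast
        linarith
    obtain ⟨m, hm⟩ := exists_nat_gt ((M - φ (z N) (z N)) / (d / 2))
    rw [div_lt_iff₀ (half_pos hd)] at hm
    have := hgrow m
    have := hzM (N + m)
    linarith
  choose k hk using hinf
  obtain ⟨xs, hxs, ψ, hψ, hlim⟩ := (hA2a β).tendsto_subseq (fun n => hzK (k n))
  have hδlim : Filter.Tendsto (fun n => δ (k (ψ n))) Filter.atTop (nhds 0) := by
    have h1 : Filter.Tendsto (fun n => δ (k n)) Filter.atTop (nhds 0) :=
      squeeze_zero (fun n => hδ0 _) (fun n => (hk n).le) tendsto_one_div_add_atTop_nhds_zero_nat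
    exact h1.comp hψ.tendsto_atTop
  refine ⟨xs, hxs.1, ?_⟩
  intro y hy
  have hyX := hDX xs hxs.1 hy
  obtain ⟨t, htD, ht⟩ := hDlsc xs hxs.1 (fun n => z (k (ψ n))) (fun n => hzX _) hlim y hy
  have htX : ∀ n, t n ∈ X := fun n => hDX _ (hzX _) (htD n)
  have hpair : Filter.Tendsto (fun n => (z (k (ψ n)), t n)) Filter.atTop
      (nhdsWithin (xs, y) (X ×ˢ X)) :=
    tendsto_nhdsWithin_iff.2 ⟨hlim.prodMk_nhds ht, Filter.Eventually.of_forall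
      (fun n => ⟨hzX _, htX n⟩)⟩
  have l1 : Filter.Tendsto (fun n => φ (z (k (ψ n))) (t n)) Filter.atTop (nhds (φ xs y)) :=
    (hφcont (xs, y) ⟨hxs.1, hyX⟩).tendsto.comp hpair
  have l2 : Filter.Tendsto (fun n => c (z (k (ψ n))) (t n)) Filter.atTop (nhds (c xs y)) :=
    (hccont (xs, y) ⟨hxs.1, hyX⟩).tendsto.comp hpair
  have l3 : Filter.Tendsto (fun n => φ (z (k (ψ n))) (z (k (ψ n)))) Filter.atTop
      (nhds (φ xs xs)) :=
    (hucont xs hxs.1).tendsto.comp (tendsto_nhdsWithin_iff.2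
      ⟨hlim, Filter.Eventually.of_forall (fun n => hzX _)⟩)
  have hfin : min 1 (φ xs y - c xs y - φ xs xs) ≤ 2 * 0 :=
    le_of_tendsto_of_tendsto' (tendsto_const_nhds.min ((l1.sub l2).sub l3))
      (hδlim.const_mul 2) (fun n => hδt _ _ (htD n))
  rcases min_le_iff.1 hfin with h | h
  · norm_num at h
  · linarith
end

section
/- (Theorem 3.1 with (A2) and (A4) replaced by (A2′) and (A4′).) Assume (A1), (A3), (A2′): for every α ∈ ℝ the set X_α = {x ∈ X : u(x) ≥ α} is compact, and (A4′): Σ_k [b(z^k,z^{k+1}) − c(z^k,z^{k+1})]_+ < ∞ along every feasible trajectory. Suppose {δ_l} is a sequence of positive reals decreasing to 0, {z^k} is a feasible trajectory with f(z^k, z^{k+1}) < 0 for all k, and σ : ℕ → ℕ is strictly increasing such that for every l the point x^l = z^{σ(l)} satisfies f(x^l, y) ≥ −δ_l for all y ∈ D(x^l). Then {x^l} has at least one limit point and every limit point x̄ of {x^l} solves Problem (P1): f(x̄, y) ≥ 0 for all y ∈ D(x̄). -/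
/-- Theorem 3.1 with (A2), (A4) replaced by (A2'), (A4'): the record points of the
threshold descent method have limit points, and every limit point solves Problem (P1). -/
theorem tdm_convergence_A2p_A4p
    {E : Type*} [MetricSpace E]
    (X : Set E) (hXne : X.Nonempty) (hXcl : IsClosed X)
    (φ c : E → E → ℝ)
    -- (A1): continuity of φ and c on X × X, nonnegativity of c, c(x,x) = 0
    (hφcont : ContinuousOn (fun p : E × E => φ p.1 p.2) (X ×ˢ X))
    (hccont : ContinuousOn (fun p : E × E => c p.1 p.2) (X ×ˢ X))
    (hcnn : ∀ x ∈ X, ∀ y ∈ X, 0 ≤ c x y)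
    (hcxx : ∀ x ∈ X, c x x = 0)
    -- the feasible-moves mapping D
    (D : E → Set E)
    (hDX : ∀ x ∈ X, D x ⊆ X)
    -- (A3): x ∈ D(x) and D is lower semicontinuous on X
    (hxD : ∀ x ∈ X, x ∈ D x)
    (hDlsc : ∀ z ∈ X, ∀ x : ℕ → E, (∀ k, x k ∈ X) →
      Filter.Tendsto x Filter.atTop (nhds z) → ∀ t ∈ D z,
      ∃ tk : ℕ → E, (∀ k, tk k ∈ D (x k)) ∧ Filter.Tendsto tk Filter.atTop (nhds t))
    -- (A2'): every superlevel set X_α is compact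
    (hA2 : ∀ α : ℝ, IsCompact {x ∈ X | α ≤ φ x x})
    -- (A4'): Σ [b - c]₊ < ∞ along every feasible trajectory
    (hA4 : ∀ z : ℕ → E, z 0 ∈ X → (∀ k, z (k + 1) ∈ D (z k)) →
      Summable (fun k => max (max (φ (z k) (z (k + 1)) - φ (z (k + 1)) (z (k + 1))) 0
        - c (z k) (z (k + 1))) 0))
    -- the thresholds δ_l ↘ 0
    (δ : ℕ → ℝ) (hδpos : ∀ l, 0 < δ l) (hδanti : Antitone δ)
    (hδ0 : Filter.Tendsto δ Filter.atTop (nhds 0))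
    -- the feasible trajectory z with f(z^k, z^{k+1}) < 0
    (z : ℕ → E) (hz0 : z 0 ∈ X) (hzD : ∀ k, z (k + 1) ∈ D (z k))
    (hdesc : ∀ k, φ (z k) (z k) + c (z k) (z (k + 1)) - φ (z k) (z (k + 1)) < 0)
    -- the record points x^l = z^(σ l) satisfying f(x^l, y) ≥ -δ_l on D(x^l)
    (σ : ℕ → ℕ) (hσ : StrictMono σ)
    (hrec : ∀ l, ∀ y ∈ D (z (σ l)),
      -δ l ≤ φ (z (σ l)) (z (σ l)) + c (z (σ l)) y - φ (z (σ l)) y) :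
    (∃ xb : E, ∃ τ : ℕ → ℕ, StrictMono τ ∧
      Filter.Tendsto (fun s => z (σ (τ s))) Filter.atTop (nhds xb)) ∧
    (∀ xb : E, (∃ τ : ℕ → ℕ, StrictMono τ ∧
        Filter.Tendsto (fun s => z (σ (τ s))) Filter.atTop (nhds xb)) →
      ∀ y ∈ D xb, 0 ≤ φ xb xb + c xb y - φ xb y) := by
  have hzX : ∀ k, z k ∈ X := by
    intro k
    induction k with
    | zero => exact hz0
    | succ k ih => exact hDX _ ih (hzD k)
  have hsum := hA4 z hz0 hzD
  set e : ℕ → ℝ := fun k => max (max (φ (z k) (z (k + 1)) - φ (z (k + 1)) (z (k + 1))) 0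
        - c (z k) (z (k + 1))) 0 with he
  have henn : ∀ k, 0 ≤ e k := fun k => le_max_right _ _
  have hstep : ∀ k, φ (z k) (z k) - e k ≤ φ (z (k + 1)) (z (k + 1)) := by
    intro k
    have h1 := hdesc k
    have h2 : max (φ (z k) (z (k + 1)) - φ (z (k + 1)) (z (k + 1))) 0
        - c (z k) (z (k + 1)) ≤ e k := le_max_left _ _
    have h3 := le_max_left (φ (z k) (z (k + 1)) - φ (z (k + 1)) (z (k + 1))) 0
    linarith
  have hlow : ∀ k, φ (z 0) (z 0) - ∑ i ∈ Finset.range k, e i ≤ φ (z k) (z k) := by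
    intro k
    induction k with
    | zero => simp
    | succ k ih =>
      rw [Finset.sum_range_succ]
      have := hstep k
      linarith
  have hmem : ∀ k, z k ∈ {x ∈ X | φ (z 0) (z 0) - ∑' i, e i ≤ φ x x} := by
    intro k
    refine ⟨hzX k, ?_⟩
    have h1 := hlow k
    have h2 := hsum.sum_le_tsum (Finset.range k) (fun i _ => henn i)
    linarith
  refine ⟨?_, ?_⟩
  · obtain ⟨a, -, τ, hτ, hlim⟩ := (hA2 _).tendsto_subseq (fun l => hmem (σ l))
    exact ⟨a, τ, hτ, hlim⟩
  · rintro xb ⟨τ, hτ, hlim⟩ y hy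
    have hxb : xb ∈ X := hXcl.mem_of_tendsto hlim (Filter.Eventually.of_forall fun s => hzX _)
    have hyX : y ∈ X := hDX _ hxb hy
    obtain ⟨t, htD, ht⟩ := hDlsc xb hxb _ (fun s => hzX (σ (τ s))) hlim y hy
    have key : ∀ (g : E → E → ℝ), ContinuousOn (fun p : E × E => g p.1 p.2) (X ×ˢ X) →
        ∀ w : ℕ → E, (∀ s, w s ∈ X) → ∀ v ∈ X, Filter.Tendsto w Filter.atTop (nhds v) →
        Filter.Tendsto (fun s => g (z (σ (τ s))) (w s)) Filter.atTop (nhds (g xb v)) := by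
      intro g hg w hw v hv hwv
      have h1 : Filter.Tendsto (fun s => (z (σ (τ s)), w s)) Filter.atTop
          (nhdsWithin (xb, v) (X ×ˢ X)) :=
        tendsto_nhdsWithin_iff.2 ⟨hlim.prodMk_nhds hwv,
          Filter.Eventually.of_forall fun s => ⟨hzX _, hw s⟩⟩
      exact (hg (xb, v) ⟨hxb, hv⟩).tendsto.comp h1
    have htX : ∀ s, t s ∈ X := fun s => hDX _ (hzX _) (htD s)
    have hL := ((key φ hφcont _ (fun s => hzX (σ (τ s))) xb hxb hlim).add
      (key c hccont t htX y hyX ht)).sub (key φ hφcont t htX y hyX ht)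
    have hδ' := (hδ0.comp hτ.tendsto_atTop).neg
    rw [neg_zero] at hδ'
    exact le_of_tendsto_of_tendsto' hδ' hL (fun s => hrec (τ s) (t s) (htD s))
end

section
/- (Theorem 3.1 with (A2) and (A4) replaced by (A2″) and (A4″).) Assume (A1), (A3), (A2″): for some α ≤ u(z^0) the set X_α = {x ∈ X : u(x) ≥ α} is compact, and (A4″): b(x,y) ≤ c(x,y) for every x ∈ X and every y ∈ D(x). Suppose {δ_l} is a sequence of positive reals decreasing to 0, {z^k} is a feasible trajectory starting at z^0 with f(z^k, z^{k+1}) < 0 for all k, and σ : ℕ → ℕ is strictly increasing such that for every l the point x^l = z^{σ(l)} satisfies f(x^l, y) ≥ −δ_l for all y ∈ D(x^l). Then {x^l} has at least one limit point and every limit point x̄ of {x^l} solves Problem (P1): f(x̄, y) ≥ 0 for all y ∈ D(x̄). -/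
/-- Theorem 3.1 with (A2), (A4) replaced by (A2''), (A4''): the record points of the
threshold descent method have limit points, and every limit point solves Problem (P1). -/
theorem tdm_convergence_A2pp_A4pp
    {E : Type*} [MetricSpace E]
    (X : Set E) (hXne : X.Nonempty) (hXcl : IsClosed X)
    (φ c : E → E → ℝ)
    -- (A1): continuity of φ and c on X × X, nonnegativity of c, c(x,x) = 0
    (hφcont : ContinuousOn (fun p : E × E => φ p.1 p.2) (X ×ˢ X))
    (hccont : ContinuousOn (fun p : E × E => c p.1 p.2) (X ×ˢ X))
    (hcnn : ∀ x ∈ X, ∀ y ∈ X, 0 ≤ c x y)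
    (hcxx : ∀ x ∈ X, c x x = 0)
    -- the feasible-moves mapping D
    (D : E → Set E)
    (hDX : ∀ x ∈ X, D x ⊆ X)
    -- (A3): x ∈ D(x) and D is lower semicontinuous on X
    (hxD : ∀ x ∈ X, x ∈ D x)
    (hDlsc : ∀ z ∈ X, ∀ x : ℕ → E, (∀ k, x k ∈ X) →
      Filter.Tendsto x Filter.atTop (nhds z) → ∀ t ∈ D z,
      ∃ tk : ℕ → E, (∀ k, tk k ∈ D (x k)) ∧ Filter.Tendsto tk Filter.atTop (nhds t))
    -- the thresholds δ_l ↘ 0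
    (δ : ℕ → ℝ) (hδpos : ∀ l, 0 < δ l) (hδanti : Antitone δ)
    (hδ0 : Filter.Tendsto δ Filter.atTop (nhds 0))
    -- the feasible trajectory z with f(z^k, z^{k+1}) < 0
    (z : ℕ → E) (hz0 : z 0 ∈ X) (hzD : ∀ k, z (k + 1) ∈ D (z k))
    (hdesc : ∀ k, φ (z k) (z k) + c (z k) (z (k + 1)) - φ (z k) (z (k + 1)) < 0)
    -- (A2''): for some α ≤ u(z^0) the set X_α is compact
    (hA2pp : ∃ α : ℝ, α ≤ φ (z 0) (z 0) ∧ IsCompact {x ∈ X | α ≤ φ x x})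
    -- (A4''): b(x,y) ≤ c(x,y) for every x ∈ X and y ∈ D(x)
    (hA4pp : ∀ x ∈ X, ∀ y ∈ D x, max (φ x y - φ y y) 0 ≤ c x y)
    -- the record points x^l = z^(σ l) satisfying f(x^l, y) ≥ -δ_l on D(x^l)
    (σ : ℕ → ℕ) (hσ : StrictMono σ)
    (hrec : ∀ l, ∀ y ∈ D (z (σ l)),
      -δ l ≤ φ (z (σ l)) (z (σ l)) + c (z (σ l)) y - φ (z (σ l)) y) :
    (∃ xb : E, ∃ τ : ℕ → ℕ, StrictMono τ ∧
      Filter.Tendsto (fun s => z (σ (τ s))) Filter.atTop (nhds xb)) ∧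
    (∀ xb : E, (∃ τ : ℕ → ℕ, StrictMono τ ∧
        Filter.Tendsto (fun s => z (σ (τ s))) Filter.atTop (nhds xb)) →
      ∀ y ∈ D xb, 0 ≤ φ xb xb + c xb y - φ xb y) := by
  have hzX : ∀ k, z k ∈ X := by
    intro k
    induction k with
    | zero => exact hz0
    | succ k ih => exact hDX _ ih (hzD k)
  have hmono : ∀ k, φ (z 0) (z 0) ≤ φ (z k) (z k) := by
    intro k
    induction k with
    | zero => exact le_refl _
    | succ k ih =>
      have h1 := hdesc k
      have h2 := le_trans (le_max_left _ _) (hA4pp _ (hzX k) _ (hzD k))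
      linarith
  constructor
  · obtain ⟨α, hα, hK⟩ := hA2pp
    obtain ⟨xb, _, τ, hτ, hlim⟩ := hK.tendsto_subseq (x := fun l => z (σ l))
      (fun l => ⟨hzX _, hα.trans (hmono _)⟩)
    exact ⟨xb, τ, hτ, hlim⟩
  · rintro xb ⟨τ, hτ, hlim⟩ y hy
    have hxb : xb ∈ X := hXcl.mem_of_tendsto hlim (Filter.Eventually.of_forall fun s => hzX _)
    have hyX : y ∈ X := hDX _ hxb hy
    obtain ⟨t, htD, ht⟩ := hDlsc xb hxb _ (fun s => hzX (σ (τ s))) hlim y hy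
    have key : ∀ g : E → E → ℝ, ContinuousOn (fun p : E × E => g p.1 p.2) (X ×ˢ X) →
        ∀ (a b : ℕ → E) (a' b' : E), a' ∈ X → b' ∈ X → (∀ s, a s ∈ X) → (∀ s, b s ∈ X) →
        Filter.Tendsto a Filter.atTop (nhds a') → Filter.Tendsto b Filter.atTop (nhds b') →
        Filter.Tendsto (fun s => g (a s) (b s)) Filter.atTop (nhds (g a' b')) := by
      intro g hg a b a' b' ha' hb' ha hb hta htb
      have h1 : Filter.Tendsto (fun s => (a s, b s)) Filter.atTop
          (nhdsWithin (a', b') (X ×ˢ X)) :=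
        tendsto_nhdsWithin_iff.2 ⟨hta.prodMk_nhds htb,
          Filter.Eventually.of_forall fun s => ⟨ha s, hb s⟩⟩
      exact (hg (a', b') ⟨ha', hb'⟩).tendsto.comp h1
    have hx : ∀ s, z (σ (τ s)) ∈ X := fun s => hzX _
    have htX : ∀ s, t s ∈ X := fun s => hDX _ (hx s) (htD s)
    have l1 := key φ hφcont _ _ _ _ hxb hxb hx hx hlim hlim
    have l2 := key c hccont _ _ _ _ hxb hyX hx htX hlim ht
    have l3 := key φ hφcont _ _ _ _ hxb hyX hx htX hlim ht
    have l4 : Filter.Tendsto (fun s => -δ (τ s)) Filter.atTop (nhds 0) := by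
      simpa using (hδ0.comp hτ.tendsto_atTop).neg
    exact le_of_tendsto_of_tendsto' l4 ((l1.add l2).sub l3) (fun s => hrec (τ s) _ (htD s))
end

section
/- (Theorem 3.1 with (A4) replaced by (A5).) Assume (A1), (A2), (A3) and (A5): (i) b(z^k,z^{k+1}) → 0 along every feasible trajectory, and (ii) Σ_k b(z^k,z^{k+1}) < ∞ along every unbounded feasible trajectory. Suppose {δ_l} is a sequence of positive reals decreasing to 0, {z^k} is a feasible trajectory with f(z^k, z^{k+1}) < 0 for all k, and σ : ℕ → ℕ is strictly increasing such that for every l the point x^l = z^{σ(l)} satisfies f(x^l, y) ≥ −δ_l for all y ∈ D(x^l). Then {x^l} has at least one limit point and every limit point x̄ of {x^l} solves Problem (P1): f(x̄, y) ≥ 0 for all y ∈ D(x̄). -/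
/-- Theorem 3.1 with (A4) replaced by (A5): the record points of the threshold
descent method have limit points, and every limit point solves Problem (P1). -/
theorem tdm_convergence_A5
    {E : Type*} [MetricSpace E]
    (X : Set E) (hXne : X.Nonempty) (hXcl : IsClosed X)
    (φ c : E → E → ℝ)
    -- (A1): continuity of φ and c on X × X, nonnegativity of c, c(x,x) = 0
    (hφcont : ContinuousOn (fun p : E × E => φ p.1 p.2) (X ×ˢ X))
    (hccont : ContinuousOn (fun p : E × E => c p.1 p.2) (X ×ˢ X))
    (hcnn : ∀ x ∈ X, ∀ y ∈ X, 0 ≤ c x y)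
    (hcxx : ∀ x ∈ X, c x x = 0)
    -- the feasible-moves mapping D
    (D : E → Set E)
    (hDX : ∀ x ∈ X, D x ⊆ X)
    -- (A3): x ∈ D(x) and D is lower semicontinuous on X
    (hxD : ∀ x ∈ X, x ∈ D x)
    (hDlsc : ∀ z ∈ X, ∀ x : ℕ → E, (∀ k, x k ∈ X) →
      Filter.Tendsto x Filter.atTop (nhds z) → ∀ t ∈ D z,
      ∃ tk : ℕ → E, (∀ k, tk k ∈ D (x k)) ∧ Filter.Tendsto tk Filter.atTop (nhds t))
    -- (A2): every superlevel set X_α is compact; every bounded subset of X lies in some X_β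
    (hA2a : ∀ α : ℝ, IsCompact {x ∈ X | α ≤ φ x x})
    (hA2b : ∀ S : Set E, S ⊆ X → Bornology.IsBounded S →
      ∃ β : ℝ, S ⊆ {x ∈ X | β ≤ φ x x})
    -- (A5)(i): b(z^k,z^{k+1}) → 0 along every feasible trajectory
    (hA5i : ∀ z : ℕ → E, z 0 ∈ X → (∀ k, z (k + 1) ∈ D (z k)) →
      Filter.Tendsto
        (fun k => max (φ (z k) (z (k + 1)) - φ (z (k + 1)) (z (k + 1))) 0)
        Filter.atTop (nhds 0))
    -- (A5)(ii): Σ b < ∞ along every unbounded feasible trajectory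
    (hA5ii : ∀ z : ℕ → E, z 0 ∈ X → (∀ k, z (k + 1) ∈ D (z k)) →
      ¬ Bornology.IsBounded (Set.range z) →
      Summable (fun k => max (φ (z k) (z (k + 1)) - φ (z (k + 1)) (z (k + 1))) 0))
    -- the thresholds δ_l ↘ 0
    (δ : ℕ → ℝ) (hδpos : ∀ l, 0 < δ l) (hδanti : Antitone δ)
    (hδ0 : Filter.Tendsto δ Filter.atTop (nhds 0))
    -- the feasible trajectory z with f(z^k, z^{k+1}) < 0
    (z : ℕ → E) (hz0 : z 0 ∈ X) (hzD : ∀ k, z (k + 1) ∈ D (z k))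
    (hdesc : ∀ k, φ (z k) (z k) + c (z k) (z (k + 1)) - φ (z k) (z (k + 1)) < 0)
    -- the record points x^l = z^(σ l) satisfying f(x^l, y) ≥ -δ_l on D(x^l)
    (σ : ℕ → ℕ) (hσ : StrictMono σ)
    (hrec : ∀ l, ∀ y ∈ D (z (σ l)),
      -δ l ≤ φ (z (σ l)) (z (σ l)) + c (z (σ l)) y - φ (z (σ l)) y) :
    (∃ xb : E, ∃ τ : ℕ → ℕ, StrictMono τ ∧
      Filter.Tendsto (fun s => z (σ (τ s))) Filter.atTop (nhds xb)) ∧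
    (∀ xb : E, (∃ τ : ℕ → ℕ, StrictMono τ ∧
        Filter.Tendsto (fun s => z (σ (τ s))) Filter.atTop (nhds xb)) →
      ∀ y ∈ D xb, 0 ≤ φ xb xb + c xb y - φ xb y) := by
  have hzX : ∀ k, z k ∈ X := by
    intro k
    induction k with
    | zero => exact hz0
    | succ k ih => exact hDX _ ih (hzD k)
  have hlev : ∃ β : ℝ, ∀ k, z k ∈ {x ∈ X | β ≤ φ x x} := by
    by_cases hb : Bornology.IsBounded (Set.range z)
    · obtain ⟨β, hβ⟩ := hA2b (Set.range z) (by rintro _ ⟨k, rfl⟩; exact hzX k) hb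
      exact ⟨β, fun k => hβ ⟨k, rfl⟩⟩
    · have hs := hA5ii z hz0 hzD hb
      set b : ℕ → ℝ := fun k => max (φ (z k) (z (k + 1)) - φ (z (k + 1)) (z (k + 1))) 0 with hbdef
      have hbn : ∀ k, 0 ≤ b k := fun k => le_max_right _ _
      have key : ∀ n, φ (z 0) (z 0) - ∑ k ∈ Finset.range n, b k ≤ φ (z n) (z n) := by
        intro n
        induction n with
        | zero => simp
        | succ n ih =>
          rw [Finset.sum_range_succ]
          have h1 : φ (z n) (z (n + 1)) - φ (z (n + 1)) (z (n + 1)) ≤ b n := le_max_left _ _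
          have h2 := hdesc n
          have h3 := hcnn _ (hzX n) _ (hzX (n + 1))
          linarith
      refine ⟨φ (z 0) (z 0) - ∑' k, b k, fun n => ⟨hzX n, ?_⟩⟩
      have h4 := hs.sum_le_tsum (Finset.range n) (fun k _ => hbn k)
      have h5 := key n
      linarith
  obtain ⟨β, hβ⟩ := hlev
  refine ⟨?_, ?_⟩
  · obtain ⟨xb, _, τ, hτ, hlim⟩ := (hA2a β).tendsto_subseq (x := fun l => z (σ l)) (fun l => hβ _)
    exact ⟨xb, τ, hτ, hlim⟩
  · rintro xb ⟨τ, hτ, hlim⟩ y hy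
    have hxb : xb ∈ X := hXcl.mem_of_tendsto hlim (Filter.Eventually.of_forall fun s => hzX _)
    obtain ⟨t, htD, ht⟩ := hDlsc xb hxb (fun s => z (σ (τ s))) (fun s => hzX _) hlim y hy
    have hyX : y ∈ X := hDX _ hxb hy
    have gen : ∀ g : E → E → ℝ, ContinuousOn (fun p : E × E => g p.1 p.2) (X ×ˢ X) →
        ∀ (v : ℕ → E) (w : E), w ∈ X → (∀ s, v s ∈ X) →
        Filter.Tendsto v Filter.atTop (nhds w) →
        Filter.Tendsto (fun s => g (z (σ (τ s))) (v s)) Filter.atTop (nhds (g xb w)) := by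
      intro g hg v w hw hv hvw
      have h1 := hg (xb, w) ⟨hxb, hw⟩
      have h2 : Filter.Tendsto (fun s => (z (σ (τ s)), v s)) Filter.atTop
          (nhdsWithin (xb, w) (X ×ˢ X)) :=
        tendsto_nhdsWithin_iff.2 ⟨hlim.prodMk_nhds hvw,
          Filter.Eventually.of_forall fun s => ⟨hzX _, hv s⟩⟩
      exact Filter.Tendsto.comp h1 h2
    have htX : ∀ s, t s ∈ X := fun s => hDX _ (hzX _) (htD s)
    have hT := ((gen φ hφcont _ xb hxb (fun s => hzX _) hlim).add
      (gen c hccont t y hyX htX ht)).sub (gen φ hφcont t y hyX htX ht)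
    have hd : Filter.Tendsto (fun s => -δ (τ s)) Filter.atTop (nhds 0) := by
      simpa using (hδ0.comp hτ.tendsto_atTop).neg
    exact le_of_tendsto_of_tendsto' hd hT (fun s => hrec _ _ (htD s))
end

section
/- (Theorem 3.1 in the case of no utility over-estimate.) Assume (A1), (A3), that φ(x,y) ≤ u(y) for every x ∈ X and every y ∈ D(x), and (A2″): for some α ≤ u(z^0) the set X_α = {x ∈ X : u(x) ≥ α} is compact. Suppose {δ_l} is a sequence of positive reals decreasing to 0, {z^k} is a feasible trajectory starting at z^0 with f(z^k, z^{k+1}) < 0 for all k, and σ : ℕ → ℕ is strictly increasing such that for every l the point x^l = z^{σ(l)} satisfies f(x^l, y) ≥ −δ_l for all y ∈ D(x^l). Then {x^l} has at least one limit point and every limit point x̄ of {x^l} solves Problem (P1): f(x̄, y) ≥ 0 for all y ∈ D(x̄). -/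
/-- Theorem 3.1 in the case of no utility over-estimate, with (A2''): the record points
of the threshold descent method have limit points, and every limit point solves (P1). -/
theorem tdm_convergence_no_overestimate
    {E : Type*} [MetricSpace E]
    (X : Set E) (hXne : X.Nonempty) (hXcl : IsClosed X)
    (φ c : E → E → ℝ)
    -- (A1): continuity of φ and c on X × X, nonnegativity of c, c(x,x) = 0
    (hφcont : ContinuousOn (fun p : E × E => φ p.1 p.2) (X ×ˢ X))
    (hccont : ContinuousOn (fun p : E × E => c p.1 p.2) (X ×ˢ X))
    (hcnn : ∀ x ∈ X, ∀ y ∈ X, 0 ≤ c x y)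
    (hcxx : ∀ x ∈ X, c x x = 0)
    -- the feasible-moves mapping D
    (D : E → Set E)
    (hDX : ∀ x ∈ X, D x ⊆ X)
    -- (A3): x ∈ D(x) and D is lower semicontinuous on X
    (hxD : ∀ x ∈ X, x ∈ D x)
    (hDlsc : ∀ z ∈ X, ∀ x : ℕ → E, (∀ k, x k ∈ X) →
      Filter.Tendsto x Filter.atTop (nhds z) → ∀ t ∈ D z,
      ∃ tk : ℕ → E, (∀ k, tk k ∈ D (x k)) ∧ Filter.Tendsto tk Filter.atTop (nhds t))
    -- the thresholds δ_l ↘ 0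
    (δ : ℕ → ℝ) (hδpos : ∀ l, 0 < δ l) (hδanti : Antitone δ)
    (hδ0 : Filter.Tendsto δ Filter.atTop (nhds 0))
    -- the feasible trajectory z with f(z^k, z^{k+1}) < 0
    (z : ℕ → E) (hz0 : z 0 ∈ X) (hzD : ∀ k, z (k + 1) ∈ D (z k))
    (hdesc : ∀ k, φ (z k) (z k) + c (z k) (z (k + 1)) - φ (z k) (z (k + 1)) < 0)
    -- (A2''): for some α ≤ u(z^0) the set X_α is compact
    (hA2pp : ∃ α : ℝ, α ≤ φ (z 0) (z 0) ∧ IsCompact {x ∈ X | α ≤ φ x x})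
    -- no utility over-estimate: φ(x,y) ≤ u(y) for every x ∈ X and y ∈ D(x)
    (hno : ∀ x ∈ X, ∀ y ∈ D x, φ x y ≤ φ y y)
    -- the record points x^l = z^(σ l) satisfying f(x^l, y) ≥ -δ_l on D(x^l)
    (σ : ℕ → ℕ) (hσ : StrictMono σ)
    (hrec : ∀ l, ∀ y ∈ D (z (σ l)),
      -δ l ≤ φ (z (σ l)) (z (σ l)) + c (z (σ l)) y - φ (z (σ l)) y) :
    (∃ xb : E, ∃ τ : ℕ → ℕ, StrictMono τ ∧
      Filter.Tendsto (fun s => z (σ (τ s))) Filter.atTop (nhds xb)) ∧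
    (∀ xb : E, (∃ τ : ℕ → ℕ, StrictMono τ ∧
        Filter.Tendsto (fun s => z (σ (τ s))) Filter.atTop (nhds xb)) →
      ∀ y ∈ D xb, 0 ≤ φ xb xb + c xb y - φ xb y) := by
  have hzX : ∀ k, z k ∈ X := by
    intro k
    induction k with
    | zero => exact hz0
    | succ n ih => exact hDX _ ih (hzD n)
  have hu : ∀ k, φ (z 0) (z 0) ≤ φ (z k) (z k) := by
    intro k
    induction k with
    | zero => exact le_rfl
    | succ n ih =>
      have h1 := hdesc n
      have h2 := hcnn _ (hzX n) _ (hzX (n + 1))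
      have h3 := hno _ (hzX n) _ (hzD n)
      linarith
  constructor
  · obtain ⟨α, hα, hK⟩ := hA2pp
    obtain ⟨xb, -, τ, hτ, hlim⟩ := hK.tendsto_subseq (x := fun l => z (σ l))
      (fun l => ⟨hzX _, hα.trans (hu _)⟩)
    exact ⟨xb, τ, hτ, hlim⟩
  · rintro xb ⟨τ, hτ, hlim⟩ y hy
    have hxb : xb ∈ X := hXcl.mem_of_tendsto hlim (Filter.Eventually.of_forall fun s => hzX _)
    obtain ⟨t, htD, ht⟩ := hDlsc xb hxb _ (fun s => hzX (σ (τ s))) hlim y hy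
    have key : ∀ g : E → E → ℝ, ContinuousOn (fun p : E × E => g p.1 p.2) (X ×ˢ X) →
        ∀ (a b : ℕ → E) (la lb : E), (∀ k, a k ∈ X) → (∀ k, b k ∈ X) → la ∈ X → lb ∈ X →
        Filter.Tendsto a Filter.atTop (nhds la) → Filter.Tendsto b Filter.atTop (nhds lb) →
        Filter.Tendsto (fun k => g (a k) (b k)) Filter.atTop (nhds (g la lb)) := by
      intro g hg a b la lb ha hb hla hlb hta htb
      have h1 := hg (la, lb) ⟨hla, hlb⟩
      have h2 : Filter.Tendsto (fun k => (a k, b k)) Filter.atTop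
          (nhdsWithin (la, lb) (X ×ˢ X)) :=
        tendsto_nhdsWithin_iff.2 ⟨hta.prodMk_nhds htb,
          Filter.Eventually.of_forall fun k => ⟨ha k, hb k⟩⟩
      exact h1.tendsto.comp h2
    have hyX : y ∈ X := hDX _ hxb hy
    have hxs : ∀ s, z (σ (τ s)) ∈ X := fun s => hzX _
    have htX : ∀ s, t s ∈ X := fun s => hDX _ (hxs s) (htD s)
    have l1 := key φ hφcont _ _ _ _ hxs hxs hxb hxb hlim hlim
    have l2 := key c hccont _ _ _ _ hxs htX hxb hyX hlim ht
    have l3 := key φ hφcont _ _ _ _ hxs htX hxb hyX hlim ht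
    have l4 : Filter.Tendsto (fun s => -δ (τ s)) Filter.atTop (nhds 0) := by
      simpa using (hδ0.comp hτ.tendsto_atTop).neg
    exact le_of_tendsto_of_tendsto' l4 ((l1.add l2).sub l3) (fun s => hrec (τ s) _ (htD s))
end

section
/- (Proposition 4.1.) Assume (B1): X is nonempty and countable, x ∈ D(x) for each x ∈ X, c(x,x) = 0 for each x ∈ X, and there exists δ > 0 such that c(x,y) ≥ δ for all x,y ∈ X with x ≠ y; and (B2): (i) u* = sup_{x ∈ X} u(x) < +∞, and (ii) b(z^k, z^{k+1}) → 0 along every feasible trajectory. Then there is no infinite sequence {z^k} ⊂ X with z^{k+1} ∈ D(z^k) and f(z^k, z^{k+1}) < 0 for all k; consequently, every run of the simple descent method (which at each step moves from z^k to some z^{k+1} ∈ D(z^k) with f(z^k, z^{k+1}) < 0) is finite and stops at a point x with f(x, y) ≥ 0 for all y ∈ D(x), i.e. at a solution of Problem (P1). -/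
/-- Proposition 4.1: under (B1)–(B2) there is no infinite feasible trajectory with
f(z^k, z^{k+1}) < 0 for all k; consequently every run of the simple descent method is
finite and stops at a solution of Problem (P1). -/
theorem sdm_finite
    {α : Type*}
    (X : Set α) (hXne : X.Nonempty) (hXcnt : X.Countable)
    (φ c : α → α → ℝ)
    (hcnn : ∀ x ∈ X, ∀ y ∈ X, 0 ≤ c x y)
    (D : α → Set α)
    (hDX : ∀ x ∈ X, D x ⊆ X)
    -- (B1): x ∈ D(x), c(x,x) = 0, and c(x,y) ≥ δ for x ≠ y
    (hxD : ∀ x ∈ X, x ∈ D x)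
    (hcxx : ∀ x ∈ X, c x x = 0)
    (hδ : ∃ δ : ℝ, 0 < δ ∧ ∀ x ∈ X, ∀ y ∈ X, x ≠ y → δ ≤ c x y)
    -- (B2)(i): u is bounded above on X
    (hubdd : ∃ M : ℝ, ∀ x ∈ X, φ x x ≤ M)
    -- (B2)(ii): b(z^k, z^{k+1}) → 0 along every feasible trajectory
    (hB2ii : ∀ z : ℕ → α, z 0 ∈ X → (∀ k, z (k + 1) ∈ D (z k)) →
      Filter.Tendsto
        (fun k => max (φ (z k) (z (k + 1)) - φ (z (k + 1)) (z (k + 1))) 0)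
        Filter.atTop (nhds 0)) :
    (¬ ∃ z : ℕ → α, z 0 ∈ X ∧ (∀ k, z (k + 1) ∈ D (z k)) ∧
      ∀ k, φ (z k) (z k) + c (z k) (z (k + 1)) - φ (z k) (z (k + 1)) < 0) ∧
    (∀ x ∈ X, (¬ ∃ y ∈ D x, φ x x + c x y - φ x y < 0) →
      ∀ y ∈ D x, 0 ≤ φ x x + c x y - φ x y) := by
  refine ⟨?_, ?_⟩
  · rintro ⟨z, h0, hD, hf⟩
    obtain ⟨δ, hδ0, hδ⟩ := hδ
    obtain ⟨M, hM⟩ := hubdd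
    have hX : ∀ k, z k ∈ X := by
      intro k
      induction k with
      | zero => exact h0
      | succ k ih => exact hDX _ ih (hD k)
    have hne : ∀ k, z k ≠ z (k + 1) := by
      intro k h
      have h1 := hf k
      rw [← h, hcxx _ (hX k)] at h1
      linarith
    have hev := (hB2ii z h0 hD).eventually (gt_mem_nhds (half_pos hδ0))
    obtain ⟨N, hN⟩ := Filter.eventually_atTop.1 hev
    have hstep : ∀ k, N ≤ k → φ (z k) (z k) + δ / 2 ≤ φ (z (k + 1)) (z (k + 1)) := by
      intro k hk
      have h1 := hN k hk
      have h2 := hδ _ (hX k) _ (hX (k + 1)) (hne k)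
      have h3 := hf k
      have h4 := le_max_left (φ (z k) (z (k + 1)) - φ (z (k + 1)) (z (k + 1))) 0
      linarith
    have hsum : ∀ n : ℕ, φ (z N) (z N) + n * (δ / 2) ≤ φ (z (N + n)) (z (N + n)) := by
      intro n
      induction n with
      | zero => simp
      | succ n ih =>
        have h1 := hstep (N + n) (Nat.le_add_right _ _)
        rw [← Nat.add_assoc]
        push_cast
        linarith
    obtain ⟨n, hn⟩ := exists_nat_gt ((M - φ (z N) (z N)) / (δ / 2))
    rw [div_lt_iff₀ (half_pos hδ0)] at hn
    have h1 := hsum n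
    have h2 := hM _ (hX (N + n))
    linarith
  · intro x _ h y hy
    by_contra hlt
    exact h ⟨y, hy, not_le.1 hlt⟩
end

section
/- (Theorem 4.1.) Assume (C1)–(C4) and (A3). Suppose {δ_l} is a sequence of positive reals decreasing to 0, {z^k} is a feasible trajectory with f(z^k, z^{k+1}) < 0 for all k, and σ : ℕ → ℕ is strictly increasing such that for every l the point x^l = z^{σ(l)} satisfies f(x^l, y) ≥ −δ_l for all y ∈ D(x^l). Then the whole sequence {z^k} converges to a point x̄ ∈ X, the sequence {x^l} converges to the same point x̄, and x̄ solves Problem (P1): f(x̄, y) ≥ 0 for all y ∈ D(x̄). -/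
/-- Theorem 4.1: under (C1)–(C4) and (A3), the trajectory of the threshold descent
method converges to a point xb ∈ X, the record points converge to the same point,
and xb solves Problem (P1). -/
theorem tdm_convergence_complete
    {E : Type*} [MetricSpace E] [CompleteSpace E]
    -- (C1): X nonempty and closed, E a complete metric space
    (X : Set E) (hXne : X.Nonempty) (hXcl : IsClosed X)
    (φ c : E → E → ℝ)
    -- (C2): φ and c are continuous on X × X, and u is bounded above on X
    (hφcont : ContinuousOn (fun p : E × E => φ p.1 p.2) (X ×ˢ X))
    (hccont : ContinuousOn (fun p : E × E => c p.1 p.2) (X ×ˢ X))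
    (hubdd : ∃ M : ℝ, ∀ x ∈ X, φ x x ≤ M)
    -- (C3): c satisfies the triangle inequality and dominates θ ∘ d
    (hctri : ∀ x ∈ X, ∀ y ∈ X, ∀ w ∈ X, c x y ≤ c x w + c w y)
    (hθ : ∃ θ : ℝ → ℝ, StrictMono θ ∧ Continuous θ ∧ θ 0 = 0 ∧
      ∀ x ∈ X, ∀ y ∈ X, θ (dist x y) ≤ c x y)
    (D : E → Set E)
    (hDX : ∀ x ∈ X, D x ⊆ X)
    -- (A3): x ∈ D(x) and D is lower semicontinuous on X
    (hxD : ∀ x ∈ X, x ∈ D x)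
    (hDlsc : ∀ z ∈ X, ∀ x : ℕ → E, (∀ k, x k ∈ X) →
      Filter.Tendsto x Filter.atTop (nhds z) → ∀ t ∈ D z,
      ∃ tk : ℕ → E, (∀ k, tk k ∈ D (x k)) ∧ Filter.Tendsto tk Filter.atTop (nhds t))
    -- (C4): Σ b(z^k, z^{k+1}) < ∞ along every feasible trajectory
    (hC4 : ∀ z : ℕ → E, z 0 ∈ X → (∀ k, z (k + 1) ∈ D (z k)) →
      Summable (fun k => max (φ (z k) (z (k + 1)) - φ (z (k + 1)) (z (k + 1))) 0))
    -- the thresholds δ_l ↘ 0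
    (δ : ℕ → ℝ) (hδpos : ∀ l, 0 < δ l) (hδanti : Antitone δ)
    (hδ0 : Filter.Tendsto δ Filter.atTop (nhds 0))
    -- the feasible trajectory z with f(z^k, z^{k+1}) < 0
    (z : ℕ → E) (hz0 : z 0 ∈ X) (hzD : ∀ k, z (k + 1) ∈ D (z k))
    (hdesc : ∀ k, φ (z k) (z k) + c (z k) (z (k + 1)) - φ (z k) (z (k + 1)) < 0)
    -- the record points x^l = z^(σ l) satisfying f(x^l, y) ≥ -δ_l on D(x^l)
    (σ : ℕ → ℕ) (hσ : StrictMono σ)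
    (hrec : ∀ l, ∀ y ∈ D (z (σ l)),
      -δ l ≤ φ (z (σ l)) (z (σ l)) + c (z (σ l)) y - φ (z (σ l)) y) :
    ∃ xb ∈ X, Filter.Tendsto z Filter.atTop (nhds xb) ∧
      Filter.Tendsto (fun l => z (σ l)) Filter.atTop (nhds xb) ∧
      ∀ y ∈ D xb, 0 ≤ φ xb xb + c xb y - φ xb y := by
  obtain ⟨M, hM⟩ := hubdd
  obtain ⟨θ, hθm, -, hθ0, hθc⟩ := hθ
  have hzX : ∀ k, z k ∈ X := by
    intro k
    induction k with
    | zero => exact hz0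
    | succ k ih => exact hDX _ ih (hzD k)
  have hcnn : ∀ x ∈ X, ∀ y ∈ X, 0 ≤ c x y := by
    intro x hx y hy
    have h1 : θ 0 ≤ θ (dist x y) := hθm.monotone dist_nonneg
    have h2 := hθc x hx y hy
    linarith
  have hb := hC4 z hz0 hzD
  have hsum : Summable (fun k => c (z k) (z (k + 1))) := by
    refine summable_of_sum_range_le
      (c := M - φ (z 0) (z 0) +
        ∑' k, max (φ (z k) (z (k + 1)) - φ (z (k + 1)) (z (k + 1))) 0)
      (fun k => hcnn _ (hzX _) _ (hzX _)) ?_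
    intro n
    have h1 : ∑ k ∈ Finset.range n, c (z k) (z (k + 1)) ≤
        φ (z n) (z n) - φ (z 0) (z 0) + ∑ k ∈ Finset.range n,
          max (φ (z k) (z (k + 1)) - φ (z (k + 1)) (z (k + 1))) 0 := by
      induction n with
      | zero => simp
      | succ n ih =>
        rw [Finset.sum_range_succ, Finset.sum_range_succ]
        have h2 := hdesc n
        have h3 := le_max_left (φ (z n) (z (n + 1)) - φ (z (n + 1)) (z (n + 1))) 0
        linarith
    have h2 := hb.sum_le_tsum (Finset.range n) (fun k _ => le_max_right _ _)
    have h3 := hM _ (hzX n)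
    linarith
  have hch : ∀ m k, c (z m) (z (m + k + 1)) ≤
      ∑ i ∈ Finset.range (m + k + 1), c (z i) (z (i + 1)) -
        ∑ i ∈ Finset.range m, c (z i) (z (i + 1)) := by
    intro m k
    induction k with
    | zero => simp [Finset.sum_range_succ]
    | succ k ih =>
      rw [← add_assoc, Finset.sum_range_succ]
      have := hctri _ (hzX m) _ (hzX (m + k + 1 + 1)) _ (hzX (m + k + 1))
      linarith
  have hS := hsum.hasSum.tendsto_sum_nat.cauchySeq
  have hcau : CauchySeq z := by
    rw [Metric.cauchySeq_iff']
    intro ε hε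
    have hpos : 0 < θ ε := by
      have := hθm hε
      linarith
    obtain ⟨N, hN⟩ := Metric.cauchySeq_iff'.1 hS (θ ε) hpos
    refine ⟨N, fun n hn => ?_⟩
    rcases hn.eq_or_lt with h | h
    · rw [← h, dist_self]; exact hε
    · obtain ⟨k, rfl⟩ := Nat.exists_eq_add_of_lt h
      have h1 := hN _ hn
      rw [Real.dist_eq] at h1
      have h2 := le_abs_self (∑ i ∈ Finset.range (N + k + 1), c (z i) (z (i + 1)) -
        ∑ i ∈ Finset.range N, c (z i) (z (i + 1)))
      have h3 := hch N k
      have h4 := hθc _ (hzX N) _ (hzX (N + k + 1))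
      rw [dist_comm]
      exact hθm.lt_iff_lt.1 (by linarith)
  obtain ⟨xb, hxb⟩ := cauchySeq_tendsto_of_complete hcau
  have hxbX : xb ∈ X := hXcl.mem_of_tendsto hxb (Filter.Eventually.of_forall hzX)
  have hx : Filter.Tendsto (fun l => z (σ l)) Filter.atTop (nhds xb) :=
    hxb.comp hσ.tendsto_atTop
  refine ⟨xb, hxbX, hxb, hx, ?_⟩
  intro y hy
  obtain ⟨t, htD, ht⟩ := hDlsc xb hxbX _ (fun l => hzX (σ l)) hx y hy
  have key : ∀ g : E → E → ℝ, ContinuousOn (fun p : E × E => g p.1 p.2) (X ×ˢ X) →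
      ∀ s : ℕ → E, (∀ l, s l ∈ X) → ∀ w ∈ X, Filter.Tendsto s Filter.atTop (nhds w) →
      Filter.Tendsto (fun l => g (z (σ l)) (s l)) Filter.atTop (nhds (g xb w)) := by
    intro g hg s hs w hw hsw
    have h1 := hg (xb, w) ⟨hxbX, hw⟩
    have h2 : Filter.Tendsto (fun l => (z (σ l), s l)) Filter.atTop
        (nhdsWithin (xb, w) (X ×ˢ X)) :=
      tendsto_nhdsWithin_iff.2 ⟨hx.prodMk_nhds hsw,
        Filter.Eventually.of_forall fun l => ⟨hzX _, hs l⟩⟩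
    exact Filter.Tendsto.comp h1 h2
  have htX : ∀ l, t l ∈ X := fun l => hDX _ (hzX _) (htD l)
  have hyX : y ∈ X := hDX _ hxbX hy
  have hlim := ((key φ hφcont _ (fun l => hzX (σ l)) xb hxbX hx).add
    (key c hccont t htX y hyX ht)).sub (key φ hφcont t htX y hyX ht)
  have hneg : Filter.Tendsto (fun l => -δ l) Filter.atTop (nhds 0) := by
    simpa using hδ0.neg
  exact le_of_tendsto_of_tendsto' hneg hlim (fun l => hrec l _ (htD l))
end

section
/- (Step 2 of the proof of Theorem 4.1.) Assume (C1)–(C4). Then every feasible trajectory {z^k} with f(z^k, z^{k+1}) < 0 for all k is a Cauchy sequence and converges to a point of X. -/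
/-- Step 2 of the proof of Theorem 4.1: under (C1)–(C4), every feasible trajectory
with f(z^k, z^{k+1}) < 0 for all k is a Cauchy sequence converging to a point of X. -/
theorem tdm_step2_complete
    {E : Type*} [MetricSpace E] [CompleteSpace E]
    -- (C1)
    (X : Set E) (hXne : X.Nonempty) (hXcl : IsClosed X)
    (φ c : E → E → ℝ)
    -- (C2)
    (hφcont : ContinuousOn (fun p : E × E => φ p.1 p.2) (X ×ˢ X))
    (hccont : ContinuousOn (fun p : E × E => c p.1 p.2) (X ×ˢ X))
    (hubdd : ∃ M : ℝ, ∀ x ∈ X, φ x x ≤ M)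
    -- (C3)
    (hctri : ∀ x ∈ X, ∀ y ∈ X, ∀ w ∈ X, c x y ≤ c x w + c w y)
    (hθ : ∃ θ : ℝ → ℝ, StrictMono θ ∧ Continuous θ ∧ θ 0 = 0 ∧
      ∀ x ∈ X, ∀ y ∈ X, θ (dist x y) ≤ c x y)
    (D : E → Set E)
    (hDX : ∀ x ∈ X, D x ⊆ X)
    -- (C4)
    (hC4 : ∀ z : ℕ → E, z 0 ∈ X → (∀ k, z (k + 1) ∈ D (z k)) →
      Summable (fun k => max (φ (z k) (z (k + 1)) - φ (z (k + 1)) (z (k + 1))) 0)) :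
    ∀ z : ℕ → E, z 0 ∈ X → (∀ k, z (k + 1) ∈ D (z k)) →
      (∀ k, φ (z k) (z k) + c (z k) (z (k + 1)) - φ (z k) (z (k + 1)) < 0) →
      CauchySeq z ∧ ∃ xb ∈ X, Filter.Tendsto z Filter.atTop (nhds xb) := by
  intro z hz0 hzD hf
  obtain ⟨M, hM⟩ := hubdd
  obtain ⟨θ, hmono, -, hθ0, hθc⟩ := hθ
  have hzX : ∀ k, z k ∈ X := by
    intro k
    induction k with
    | zero => exact hz0
    | succ k ih => exact hDX _ ih (hzD k)
  have hb := hC4 z hz0 hzD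
  have hc0 : ∀ k, 0 ≤ c (z k) (z (k + 1)) := fun k => by
    have h1 := hθc _ (hzX k) _ (hzX (k + 1))
    have h2 : θ 0 ≤ θ (dist (z k) (z (k + 1))) := hmono.monotone dist_nonneg
    linarith
  have hpart : ∀ n, ∑ k ∈ Finset.range n, c (z k) (z (k + 1)) ≤
      φ (z n) (z n) - φ (z 0) (z 0) + ∑ k ∈ Finset.range n,
        max (φ (z k) (z (k + 1)) - φ (z (k + 1)) (z (k + 1))) 0 := by
    intro n
    induction n with
    | zero => simp
    | succ n ih =>
      rw [Finset.sum_range_succ, Finset.sum_range_succ]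
      have h1 := hf n
      have h2 := le_max_left (φ (z n) (z (n + 1)) - φ (z (n + 1)) (z (n + 1))) 0
      linarith
  have hsum : Summable (fun k => c (z k) (z (k + 1))) := by
    refine summable_of_sum_range_le hc0 (c := M - φ (z 0) (z 0) + ∑' k,
        max (φ (z k) (z (k + 1)) - φ (z (k + 1)) (z (k + 1))) 0) fun n => ?_
    have h1 := hpart n
    have h2 := hM _ (hzX n)
    have h3 := hb.sum_le_tsum (Finset.range n) (fun i _ => le_max_right _ _)
    linarith
  have htel : ∀ N k, c (z N) (z (N + k + 1)) ≤
      ∑ i ∈ Finset.range (N + k + 1), c (z i) (z (i + 1)) -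
      ∑ i ∈ Finset.range N, c (z i) (z (i + 1)) := by
    intro N k
    induction k with
    | zero => simp [Finset.sum_range_succ]
    | succ k ih =>
      have h1 := hctri _ (hzX N) _ (hzX (N + k + 1 + 1)) _ (hzX (N + k + 1))
      have h2 := Finset.sum_range_succ (fun i => c (z i) (z (i + 1))) (N + k + 1)
      rw [← add_assoc, h2]
      linarith
  have hC : CauchySeq z := by
    rw [Metric.cauchySeq_iff']
    intro ε hε
    have hθε : 0 < θ ε := by rw [← hθ0]; exact hmono hε
    obtain ⟨N, hN⟩ := Metric.cauchySeq_iff'.1 hsum.hasSum.tendsto_sum_nat.cauchySeq (θ ε) hθε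
    refine ⟨N, fun n hn => ?_⟩
    rcases hn.eq_or_lt with rfl | hlt
    · simpa using hε
    · obtain ⟨k, rfl⟩ := Nat.exists_eq_add_of_lt hlt
      have h1 := hN _ hn
      rw [Real.dist_eq] at h1
      have h2 := htel N k
      have h3 := hθc _ (hzX N) _ (hzX (N + k + 1))
      rw [dist_comm]
      exact hmono.lt_iff_lt.1 (lt_of_le_of_lt (h3.trans (h2.trans (le_abs_self _))) h1)
  obtain ⟨x, hx⟩ := cauchySeq_tendsto_of_complete hC
  exact ⟨hC, x, hXcl.mem_of_tendsto hx (Filter.Eventually.of_forall hzX), hx⟩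
end
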